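/- arXiv:1412.7565 — 8 statements merged into one kernel-verified Lean document; each statement's English description precedes it below -/
import Mathlib

section
/- Let d be a positive natural number and let u : ℝ^d → ℝ be a Lipschitz function. Let w = min(max(u,0),1) be the unit contraction of u (so w is again Lipschitz). Then the Dirichlet energy does not increase under the unit contraction: ∫_{ℝ^d} ‖Dw(x)‖² dx ≤ ∫_{ℝ^d} ‖Du(x)‖² dx, where the integrals are Lebesgue integrals (possibly infinite) and Du(x), Dw(x) denote the total derivatives (which exist a.e. by Rademacher's theorem and are taken to be 0 at points of non-differentiability). -/
open MeasureTheory

/-- If the increments of `g` at `x` are dominated by those of `f`, and `f` is differentiable at `x`,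
then the derivative of `g` at `x` is dominated by that of `f`. -/
theorem norm_fderiv_le_of_eventually_norm_sub_le {𝕜 E F G : Type*} [NontriviallyNormedField 𝕜]
    [NormedAddCommGroup E] [NormedSpace 𝕜 E] [NormedAddCommGroup F] [NormedSpace 𝕜 F]
    [NormedAddCommGroup G] [NormedSpace 𝕜 G] {f : E → F} {g : E → G} {x : E}
    (hf : DifferentiableAt 𝕜 f x)
    (hgf : ∀ᶠ y in nhds x, ‖g y - g x‖ ≤ ‖f y - f x‖) :
    ‖fderiv 𝕜 g x‖ ≤ ‖fderiv 𝕜 f x‖ := by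
  refine le_of_forall_pos_le_add fun ε hε => norm_fderiv_le_of_lip' 𝕜 (by positivity) ?_
  filter_upwards [hgf, hf.hasFDerivAt.isLittleO.bound hε] with y hy hb
  calc ‖g y - g x‖ ≤ ‖f y - f x‖ := hy
    _ = ‖(f y - f x - fderiv 𝕜 f x (y - x)) + fderiv 𝕜 f x (y - x)‖ := by rw [sub_add_cancel]
    _ ≤ ε * ‖y - x‖ + ‖fderiv 𝕜 f x‖ * ‖y - x‖ :=
      norm_add_le_of_le hb ((fderiv 𝕜 f x).le_opNorm _)
    _ = (‖fderiv 𝕜 f x‖ + ε) * ‖y - x‖ := by ring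

/-- The unit contraction `t ↦ min (max t 0) 1` does not increase distances. -/
theorem abs_min_max_sub_min_max_le (a b : ℝ) :
    |min (max a 0) 1 - min (max b 0) 1| ≤ |a - b| :=
  (abs_min_sub_min_le_max _ _ _ _).trans <| by
    simpa using abs_max_sub_max_le_max a 0 b 0

/-- The Dirichlet energy does not increase under the unit contraction
`w = min (max u 0) 1` of a Lipschitz function `u : ℝ^d → ℝ`. -/
theorem dirichlet_energy_le_of_unit_contraction
    (d : ℕ) (hd : 0 < d)
    (u : EuclideanSpace ℝ (Fin d) → ℝ) (K : NNReal) (hu : LipschitzWith K u)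
    (w : EuclideanSpace ℝ (Fin d) → ℝ)
    (hw : w = fun x => min (max (u x) 0) 1) :
    ∫⁻ x, ENNReal.ofReal (‖fderiv ℝ w x‖ ^ 2) ≤
      ∫⁻ x, ENNReal.ofReal (‖fderiv ℝ u x‖ ^ 2) := by
  subst hw
  refine lintegral_mono_ae ?_
  filter_upwards [hu.ae_differentiableAt] with x hx
  gcongr
  exact norm_fderiv_le_of_eventually_norm_sub_le hx
    (.of_forall fun y => abs_min_max_sub_min_max_le (u y) (u x))
end

section
/- Let d be a positive natural number and let u : ℝ^d → ℝ be a Lipschitz function with compact support, and let w = min(max(u,0),1) be its unit contraction. Then the gradient form satisfies the Markov property (E.4): ∫_{ℝ^d} ⟨∇w(x), ∇u(x) − ∇w(x)⟩ dx ≥ 0, where ∇ denotes the a.e.-defined gradient (taken to be 0 at points of non-differentiability) and the integral is with respect to Lebesgue measure. -/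
open MeasureTheory
open scoped RealInnerProductSpace

/-- At every point, either the unit contraction of a continuous function has zero gradient, or its
gradient agrees with that of the function. -/
theorem gradient_unitContraction_eq_zero_or_eq {E : Type*} [NormedAddCommGroup E]
    [InnerProductSpace ℝ E] [CompleteSpace E] {u : E → ℝ} (hu : Continuous u) (x : E) :
    gradient (fun y => min (max (u y) 0) 1) x = 0 ∨
      gradient (fun y => min (max (u y) 0) 1) x = gradient u x := by
  rcases le_or_gt (u x) 0 with h0 | h0
  · left
    have hmin : IsLocalMin (fun y => min (max (u y) 0) 1) x :=
      Filter.Eventually.of_forall fun y => by simp [h0]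
    simp [gradient, hmin.fderiv_eq_zero]
  rcases le_or_gt 1 (u x) with h1 | h1
  · left
    have hmax : IsLocalMax (fun y => min (max (u y) 0) 1) x :=
      Filter.Eventually.of_forall fun y => by simp [h1]
    simp [gradient, hmax.fderiv_eq_zero]
  · right
    have heq : (fun y => min (max (u y) 0) 1) =ᶠ[nhds x] u := by
      filter_upwards [hu.continuousAt.eventually_const_lt h0,
        hu.continuousAt.eventually_lt_const h1] with y hy0 hy1
      rw [max_eq_left hy0.le, min_eq_left hy1.le]
    simp [gradient, heq.fderiv_eq]

/-- The gradient Dirichlet form satisfies the Markov property (E.4):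
for a compactly supported Lipschitz `u : ℝ^d → ℝ` with unit contraction
`w = min (max u 0) 1`, one has `∫ ⟨∇w, ∇u − ∇w⟩ ≥ 0`. -/
theorem gradient_form_markov_property
    (d : ℕ) (hd : 0 < d)
    (u : EuclideanSpace ℝ (Fin d) → ℝ) (K : NNReal) (hu : LipschitzWith K u)
    (hsupp : HasCompactSupport u)
    (w : EuclideanSpace ℝ (Fin d) → ℝ)
    (hw : w = fun x => min (max (u x) 0) 1) :
    0 ≤ ∫ x, ⟪gradient w x, gradient u x - gradient w x⟫ := by
  subst hw
  refine integral_nonneg fun x => ?_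
  rcases gradient_unitContraction_eq_zero_or_eq hu.continuous x with h | h <;> simp [h]
end

section
/- Let d be a positive natural number and let u : ℝ^d → ℝ be a Lipschitz function with compact support, and let w = min(max(u,0),1) be its unit contraction. Then ∫_{ℝ^d} ⟨∇u(x), ∇w(x)⟩ dx ≥ ∫_{ℝ^d} ‖∇w(x)‖² dx, where ∇ denotes the a.e.-defined gradient (taken to be 0 at points of non-differentiability) and the integrals are with respect to Lebesgue measure. -/
open MeasureTheory
open scoped RealInnerProductSpace

/-- The gradient of the unit contraction of a continuous function satisfies
`‖∇w‖² = ⟨∇u, ∇w⟩` at every point: where `0 < u < 1` the functions agree locally, and elsewhere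
`w` attains a global extremum. -/
theorem norm_gradient_contraction_sq {F : Type*} [NormedAddCommGroup F] [InnerProductSpace ℝ F]
    [CompleteSpace F] {u : F → ℝ} (hu : Continuous u) (x : F) :
    ‖gradient (fun y => min (max (u y) 0) 1) x‖ ^ 2 =
      ⟪gradient u x, gradient (fun y => min (max (u y) 0) 1) x⟫ := by
  by_cases h : 0 < u x ∧ u x < 1
  · have hev : (fun y => min (max (u y) 0) 1) =ᶠ[nhds x] u := by
      filter_upwards [hu.continuousAt.eventually (lt_mem_nhds h.1),
        hu.continuousAt.eventually (gt_mem_nhds h.2)] with y hy0 hy1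
      rw [max_eq_left hy0.le, min_eq_left hy1.le]
    have hgrad : gradient (fun y => min (max (u y) 0) 1) x = gradient u x := by
      rw [gradient, gradient, hev.fderiv_eq]
    rw [hgrad, real_inner_self_eq_norm_sq]
  · have hext : IsLocalExtr (fun y => min (max (u y) 0) 1) x := by
      rcases le_or_gt (u x) 0 with h0 | h0
      · refine Or.inl (Filter.Eventually.of_forall fun y => ?_)
        simp [max_eq_right h0]
      · refine Or.inr (Filter.Eventually.of_forall fun y => ?_)
        have h1 : 1 ≤ u x := not_lt.1 fun h1 => h ⟨h0, h1⟩
        simp [h1]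
    have hgrad : gradient (fun y => min (max (u y) 0) 1) x = 0 := by
      rw [gradient, hext.fderiv_eq_zero, map_zero]
    simp [hgrad]

/-- For a compactly supported Lipschitz `u : ℝ^d → ℝ` with unit contraction
`w = min (max u 0) 1`, one has `∫ ⟨∇u, ∇w⟩ ≥ ∫ ‖∇w‖²`. -/
theorem inner_gradient_contraction_ge
    (d : ℕ) (hd : 0 < d)
    (u : EuclideanSpace ℝ (Fin d) → ℝ) (K : NNReal) (hu : LipschitzWith K u)
    (hsupp : HasCompactSupport u)
    (w : EuclideanSpace ℝ (Fin d) → ℝ)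
    (hw : w = fun x => min (max (u x) 0) 1) :
    ∫ x, ‖gradient w x‖ ^ 2 ≤ ∫ x, ⟪gradient u x, gradient w x⟫ := by
  subst hw
  exact (integral_congr_ae (Filter.Eventually.of_forall fun x =>
    norm_gradient_contraction_sq hu.continuous x)).le
end

section
/- Let d be a positive natural number, let b : ℝ^d → ℝ^d be a bounded measurable vector field, let u : ℝ^d → ℝ be a Lipschitz function with compact support, and let w = min(max(u,0),1) be its unit contraction. Then the drift-perturbed form satisfies the Markov property (E.4): ∫_{ℝ^d} ⟨∇w(x), ∇u(x) − ∇w(x)⟩ dx + ∫_{ℝ^d} ⟨b(x), ∇w(x)⟩ (u(x) − w(x)) dx ≥ 0, where ∇ denotes the a.e.-defined gradient (taken to be 0 at points of non-differentiability). -/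
open MeasureTheory
open scoped RealInnerProductSpace

/-- Off the strip `{0 < u < 1}`, the unit contraction of `u` attains a global extremum,
so its gradient vanishes there. No regularity of `u` is needed. -/
theorem gradient_unitContraction_eq_zero {E : Type*} [NormedAddCommGroup E]
    [InnerProductSpace ℝ E] [CompleteSpace E] (u : E → ℝ) {x : E} (h : u x ≤ 0 ∨ 1 ≤ u x) :
    gradient (fun y => min (max (u y) 0) 1) x = 0 := by
  rw [gradient, map_eq_zero_iff _ (LinearIsometryEquiv.injective _)]
  rcases h with h | h
  · refine IsLocalMin.fderiv_eq_zero (Filter.Eventually.of_forall fun y => ?_)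
    beta_reduce
    rw [max_eq_right h, min_eq_left zero_le_one]
    exact le_min (le_max_right _ _) zero_le_one
  · refine IsLocalMax.fderiv_eq_zero (Filter.Eventually.of_forall fun y => ?_)
    beta_reduce
    rw [min_eq_right (h.trans (le_max_left _ _))]
    exact min_le_right _ _

/-- On the strip `{0 < u < 1}`, a continuous `u` locally agrees with its unit contraction. -/
theorem unitContraction_eventuallyEq {X : Type*} [TopologicalSpace X] {u : X → ℝ} {x : X}
    (hu : ContinuousAt u x) (h0 : 0 < u x) (h1 : u x < 1) :
    (fun y => min (max (u y) 0) 1) =ᶠ[nhds x] u := by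
  filter_upwards [hu.eventually_const_lt h0, hu.eventually_lt_const h1] with y hy0 hy1
  rw [max_eq_left hy0.le, min_eq_left hy1.le]

/-- The drift-perturbed form `E⁽³⁾(f,g) = ∫ ⟨∇f, ∇g⟩ + ∫ ⟨b, ∇f⟩ g` with a bounded
measurable vector field `b` satisfies the Markov property (E.4): for a compactly
supported Lipschitz `u` with unit contraction `w = min (max u 0) 1`,
`E⁽³⁾(w, u − w) ≥ 0`. -/
theorem drift_form_markov_property
    (d : ℕ) (hd : 0 < d) (M : ℝ)
    (b : EuclideanSpace ℝ (Fin d) → EuclideanSpace ℝ (Fin d))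
    (hb : Measurable b) (hbM : ∀ x, ‖b x‖ ≤ M)
    (u : EuclideanSpace ℝ (Fin d) → ℝ) (K : NNReal) (hu : LipschitzWith K u)
    (hsupp : HasCompactSupport u)
    (w : EuclideanSpace ℝ (Fin d) → ℝ)
    (hw : w = fun x => min (max (u x) 0) 1) :
    0 ≤ (∫ x, ⟪gradient w x, gradient u x - gradient w x⟫) +
        ∫ x, ⟪b x, gradient w x⟫ * (u x - w x) := by
  have key : ∀ x, gradient w x = 0 ∨ (gradient w x = gradient u x ∧ w x = u x) := by
    intro x
    subst hw
    by_cases h : u x ≤ 0 ∨ 1 ≤ u x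
    · exact Or.inl (gradient_unitContraction_eq_zero u h)
    · push Not at h
      have hloc := unitContraction_eventuallyEq hu.continuous.continuousAt h.1 h.2
      exact Or.inr ⟨by rw [gradient, gradient, hloc.fderiv_eq], hloc.eq_of_nhds⟩
  have h1 : ∀ x, ⟪gradient w x, gradient u x - gradient w x⟫ = 0 := fun x => by
    rcases key x with h | h <;> simp [h]
  have h2 : ∀ x, ⟪b x, gradient w x⟫ * (u x - w x) = 0 := fun x => by
    rcases key x with h | h <;> simp [h]
  simp only [h1, h2, integral_zero, add_zero, le_refl]
end

section
/- Let H be a real Hilbert space, F ⊆ H a dense subspace which is itself a real Hilbert space with norm ‖·‖_F whose inclusion into H is continuous, E : F → F → ℝ a bilinear form, α ≥ 0, K ≥ 1 constants such that: E(u,u) + α‖u‖_H² ≥ 0 for all u ∈ F; |E(u,v)| ≤ K‖u‖_F‖v‖_F for all u,v ∈ F; and for every β > α there is c_β > 0 with E(u,u) + β‖u‖_H² ≥ c_β‖u‖_F² for all u ∈ F. Let G : (α,∞) → H → F be a family of maps such that for every β > α and f ∈ H, E(G_β f, u) + β⟨G_β f, u⟩_H = ⟨f,u⟩_H for all u ∈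 F. Then the resolvents are strongly continuous: for every f ∈ H, β G_β f converges to f in H as β → ∞, i.e. ‖β G_β f − f‖_H → 0. -/
open scoped RealInnerProductSpace

/-- Strong continuity of the resolvents: `β G_β f → f` in `H` as `β → ∞`. -/
theorem resolvent_strong_continuity
    {H : Type*} [NormedAddCommGroup H] [InnerProductSpace ℝ H] [CompleteSpace H]
    {F : Type*} [NormedAddCommGroup F] [InnerProductSpace ℝ F] [CompleteSpace F]
    (ι : F →L[ℝ] H) (hinj : Function.Injective ι) (hdense : DenseRange ι)
    (E : F →ₗ[ℝ] F →ₗ[ℝ] ℝ) (α K : ℝ) (hα : 0 ≤ α) (hK : 1 ≤ K)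
    (h1 : ∀ u : F, 0 ≤ E u u + α * ‖ι u‖ ^ 2)
    (h2 : ∀ u v : F, |E u v| ≤ K * ‖u‖ * ‖v‖)
    (h3 : ∀ β > α, ∃ c > 0, ∀ u : F, c * ‖u‖ ^ 2 ≤ E u u + β * ‖ι u‖ ^ 2)
    (G : ℝ → H → F)
    (hG : ∀ β > α, ∀ f : H, ∀ u : F,
      E (G β f) u + β * ⟪ι (G β f), ι u⟫ = ⟪f, ι u⟫)
    (f : H) :
    Filter.Tendsto (fun β : ℝ => β • ι (G β f)) Filter.atTop (nhds f) := by
  obtain ⟨c, hc, hcoer⟩ := h3 (α + 1) (by linarith)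
  rw [Metric.tendsto_nhds]
  intro δ hδ
  obtain ⟨ε, hε, hεδ⟩ : ∃ ε > 0, 3 * ε < δ := ⟨δ / 4, by linarith, by linarith⟩
  obtain ⟨v, hv⟩ := hdense.exists_dist_lt f hε
  rw [dist_eq_norm] at hv
  set M : ℝ := (K * ‖v‖) ^ 2 / (4 * c) with hM
  filter_upwards [Filter.eventually_ge_atTop (4 * (α + 1)),
    Filter.eventually_ge_atTop (M / ε ^ 2)] with β hβ hβM
  have hβpos : 0 < β := by linarith
  set w : F := β • G β f - v with hw
  have hιw : ι w = β • ι (G β f) - ι v := by simp [hw]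
  have hres := hG β (by linarith) f w
  have hweak : E w w + β * ‖ι w‖ ^ 2 = β * ⟪f - ι v, ι w⟫ - E v w := by
    have hE : E w w = β * E (G β f) w - E v w := by
      have : E w = β • E (G β f) - E v := by simp only [hw, map_sub, map_smul]
      simp only [this, LinearMap.sub_apply, LinearMap.smul_apply, smul_eq_mul]
    have hI : ‖ι w‖ ^ 2 = β * ⟪ι (G β f), ι w⟫ - ⟪ι v, ι w⟫ := by
      rw [← real_inner_self_eq_norm_sq]
      nth_rewrite 1 [hιw]
      rw [inner_sub_left, real_inner_smul_left]
    rw [hE, hI, inner_sub_left]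
    linear_combination β * hres
  have hcs : ⟪f - ι v, ι w⟫ ≤ ε * ‖ι w‖ :=
    (real_inner_le_norm _ _).trans (mul_le_mul_of_nonneg_right hv.le (norm_nonneg _))
  have hEv : -E v w ≤ K * ‖v‖ * ‖w‖ := (neg_le_abs _).trans (h2 v w)
  have hyoung : K * ‖v‖ * ‖w‖ ≤ c * ‖w‖ ^ 2 + M := by
    have : c * ‖w‖ ^ 2 + M - K * ‖v‖ * ‖w‖ = (2 * c * ‖w‖ - K * ‖v‖) ^ 2 / (4 * c) := by
      rw [hM]
      field_simp
      ring
    have : 0 ≤ (2 * c * ‖w‖ - K * ‖v‖) ^ 2 / (4 * c) := by positivity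
    linarith
  have hMβ : M ≤ β * ε ^ 2 := (div_le_iff₀ (by positivity)).1 hβM
  have hquad : β * (3 / 4 * ‖ι w‖ ^ 2) ≤ β * (ε * ‖ι w‖ + ε ^ 2) := by
    have := hcoer w
    have := mul_le_mul_of_nonneg_left hcs hβpos.le
    have := mul_le_mul_of_nonneg_right hβ (sq_nonneg ‖ι w‖)
    linarith
  have hwε : ‖ι w‖ ≤ 2 * ε := by
    have := le_of_mul_le_mul_left hquad hβpos
    by_contra! h
    nlinarith
  rw [dist_eq_norm]
  calc ‖β • ι (G β f) - f‖ = ‖ι w - (f - ι v)‖ := by rw [hιw]; congr 1; abel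
    _ ≤ ‖ι w‖ + ‖f - ι v‖ := norm_sub_le _ _
    _ < δ := by linarith
end

section
/- Let (X,m) be a measure space and H = L²(X,m) the real Hilbert space of square-integrable functions. Let F ⊆ H be a dense subspace which is itself a real Hilbert space with norm ‖·‖_F whose inclusion into H is continuous, E : F → F → ℝ a bilinear form, and α ≥ 0, K ≥ 1 constants such that: E(u,u) + α‖u‖_H² ≥ 0 for all u ∈ F; |E(u,v)| ≤ K‖u‖_F‖v‖_F for all u,v ∈ F; for every β > α there is c_β > 0 with E(u,u) + β‖u‖_H² ≥ c_β‖u‖_F² for all u ∈ F. Assume the Markov property (E.4): for every u ∈ F, the unit contraction u⁺ ∧ 1 belongs to F and E(u⁺ ∧ 1, u − u⁺ ∧ 1) ≥ 0. Then the resolvents are sub-Markov: for every β > α and every f ∈ H with 0 ≤ f ≤ 1 m-a.e., the unique g ∈ F satisfying E(g,u) + β⟨g,u⟩_H = ⟨f,u⟩_H for all u ∈ F satisfies 0 ≤ β g ≤ 1 m-a.e. -/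
open MeasureTheory
open scoped RealInnerProductSpace

/-- The unit contraction `w` of `u` is the `L²`-projection of `u` onto `{0 ≤ f ≤ 1}`:
the variational inequality for it. -/
theorem inner_sub_unitContraction_nonpos {X : Type*} [MeasurableSpace X] {m : Measure X}
    {f u w : Lp ℝ 2 m} (hf : ∀ᵐ x ∂m, 0 ≤ f x ∧ f x ≤ 1)
    (hw : (w : X → ℝ) =ᵐ[m] fun x => min (max (u x) 0) 1) :
    ⟪f - w, u - w⟫ ≤ 0 := by
  rw [L2.inner_def]
  apply integral_nonpos_of_ae
  filter_upwards [hf, hw, Lp.coeFn_sub f w, Lp.coeFn_sub u w] with x ⟨h0, h1⟩ hwx hfw huw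
  simp only [hfw, huw, Pi.sub_apply, hwx, Pi.zero_apply,
    RCLike.inner_apply, conj_trivial]
  rcases le_total (u x) 0 with h | h
  · rw [max_eq_right h, min_eq_left zero_le_one]
    nlinarith
  · rw [max_eq_left h]
    rcases le_total (u x) 1 with h' | h'
    · simp [min_eq_left h']
    · rw [min_eq_right h']
      nlinarith

/-- The Markov property (E.4) of a lower bounded semi-Dirichlet form on `L²(X,m)`
implies that the resolvents are sub-Markov: if `0 ≤ f ≤ 1` a.e. then
`0 ≤ β G_β f ≤ 1` a.e. -/
theorem resolvent_subMarkov_of_markov_property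
    {X : Type*} [MeasurableSpace X] (m : Measure X)
    {F : Type*} [NormedAddCommGroup F] [InnerProductSpace ℝ F] [CompleteSpace F]
    (ι : F →L[ℝ] Lp ℝ 2 m) (hinj : Function.Injective ι) (hdense : DenseRange ι)
    (E : F →ₗ[ℝ] F →ₗ[ℝ] ℝ) (α K : ℝ) (hα : 0 ≤ α) (hK : 1 ≤ K)
    (h1 : ∀ u : F, 0 ≤ E u u + α * ‖ι u‖ ^ 2)
    (h2 : ∀ u v : F, |E u v| ≤ K * ‖u‖ * ‖v‖)
    (h3 : ∀ β > α, ∃ c > 0, ∀ u : F, c * ‖u‖ ^ 2 ≤ E u u + β * ‖ι u‖ ^ 2)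
    (h4 : ∀ u : F, ∃ w : F,
      (ι w : X → ℝ) =ᵐ[m] (fun x => min (max (ι u x) 0) 1) ∧ 0 ≤ E w (u - w))
    (β : ℝ) (hβ : α < β) (f : Lp ℝ 2 m)
    (hf : ∀ᵐ x ∂m, 0 ≤ f x ∧ f x ≤ 1)
    (g : F) (hg : ∀ u : F, E g u + β * ⟪ι g, ι u⟫ = ⟪f, ι u⟫) :
    ∀ᵐ x ∂m, 0 ≤ β * ι g x ∧ β * ι g x ≤ 1 := by
  obtain ⟨w, hw, hEw⟩ := h4 (β • g)
  obtain ⟨c, hc, hcoer⟩ := h3 β hβ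
  have hres := hg (β • g - w)
  have hproj := inner_sub_unitContraction_nonpos hf hw
  have hβ0 : 0 < β := hα.trans_lt hβ
  have hform : E (β • g - w) (β • g - w) = β * E g (β • g - w) - E w (β • g - w) := by
    rw [map_sub E, LinearMap.sub_apply, map_smul E, LinearMap.smul_apply, smul_eq_mul]
  have hinner : ⟪f - ι w, ι (β • g) - ι w⟫ =
      ⟪f, ι (β • g - w)⟫ - β * ⟪ι g, ι (β • g - w)⟫ + ‖ι (β • g - w)‖ ^ 2 := by
    rw [← real_inner_self_eq_norm_sq, ← real_inner_smul_left, ← inner_sub_left,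
      ← inner_add_left, ← map_sub, map_sub, map_smul]
    congr 1
    abel
  have hle : c * ‖β • g - w‖ ^ 2 ≤ 0 := by
    nlinarith [hcoer (β • g - w), mul_nonpos_of_nonneg_of_nonpos hβ0.le hproj]
  have heq : β • g = w := by
    rw [← sub_eq_zero, ← norm_eq_zero, ← sq_eq_zero_iff]
    exact le_antisymm (nonpos_of_mul_nonpos_right hle hc) (sq_nonneg _)
  rw [← heq, map_smul] at hw
  filter_upwards [hw, Lp.coeFn_smul β (ι g)] with x hx hsx
  rw [hsx, Pi.smul_apply, smul_eq_mul] at hx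
  rw [hx]
  exact ⟨le_min (le_max_right _ _) zero_le_one, min_le_right _ _⟩
end

section
/- Let (X,m) be a measure space and H = L²(X,m) the real Hilbert space of square-integrable functions. Let F ⊆ H be a dense subspace which is itself a real Hilbert space with norm ‖·‖_F whose inclusion into H is continuous, E : F → F → ℝ a bilinear form, and α ≥ 0, K ≥ 1 constants such that: E(u,u) + α‖u‖_H² ≥ 0 for all u ∈ F; |E(u,v)| ≤ K‖u‖_F‖v‖_F for all u,v ∈ F; for every β > α there is c_β > 0 with E(u,u) + β‖u‖_H² ≥ c_β‖u‖_F² for all u ∈ F. Let G : (α,∞) → H → F assign to each β > α and f ∈ H the unique G_β f ∈ F with E(G_β f, u) + β⟨G_β f, u⟩_H = ⟨f,u⟩_H for all u ∈ F. If for every β > α and every f ∈ H with 0 ≤ f ≤ 1 m-a.e. one has 0 ≤ β G_β f ≤ 1 m-a.e., then the Markov property (E.4) holds: for every u ∈ F, the unit contraction u⁺ ∧ 1 belongs to F and E(u⁺ ∧ 1, u − u⁺ ∧ 1) ≥ 0. -/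
open MeasureTheory Filter Topology
open scoped RealInnerProductSpace

/-- A bounded sequence in a real Hilbert space converges weakly along some ultrafilter finer
than `atTop`. -/
theorem exists_ultrafilter_tendsto_weak
    {F : Type*} [NormedAddCommGroup F] [InnerProductSpace ℝ F] [CompleteSpace F]
    {v : ℕ → F} {R : ℝ} (hv : ∀ n, ‖v n‖ ≤ R) :
    ∃ l : Ultrafilter ℕ, (l : Filter ℕ) ≤ atTop ∧ ∃ w : F,
      ∀ φ : F →L[ℝ] ℝ, Tendsto (fun n => φ (v n)) l (𝓝 (φ w)) := by
  let d : ℕ → WeakDual ℝ F :=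
    fun n => StrongDual.toWeakDual (InnerProductSpace.toDual ℝ F (v n))
  have hl : (hyperfilter ℕ : Filter ℕ) ≤ atTop := by
    rw [← Nat.cofinite_eq_atTop]
    exact hyperfilter_le_cofinite
  have hd : ∀ n, d n ∈ WeakDual.toStrongDual ⁻¹'
      Metric.closedBall (0 : StrongDual ℝ F) R := by
    intro n
    simpa [d] using hv n
  obtain ⟨y, -, hy⟩ := (WeakDual.isCompact_closedBall (𝕜 := ℝ) (0 : StrongDual ℝ F) R
    ).ultrafilter_le_nhds ((hyperfilter ℕ).map d)
    (le_principal_iff.2 (Filter.mem_map.2 (Filter.univ_mem' hd)))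
  have hy' : Tendsto d (hyperfilter ℕ) (𝓝 y) := hy
  refine ⟨hyperfilter ℕ, hl,
    (InnerProductSpace.toDual ℝ F).symm (WeakDual.toStrongDual y), fun φ => ?_⟩
  have h := ((WeakDual.eval_continuous ((InnerProductSpace.toDual ℝ F).symm φ)).tendsto y).comp hy'
  have key : ∀ x : F, φ x = ⟪x, (InnerProductSpace.toDual ℝ F).symm φ⟫ := by
    intro x
    rw [real_inner_comm, InnerProductSpace.toDual_symm_apply]
  simp only [key, InnerProductSpace.toDual_symm_apply]
  exact h

/-- The unit contraction of an `L²` function is again in `L²`. -/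
theorem exists_Lp_coeFn_eq_unitContraction {X : Type*} [MeasurableSpace X] {m : Measure X}
    (f : Lp ℝ 2 m) :
    ∃ g : Lp ℝ 2 m, (g : X → ℝ) =ᵐ[m] fun x => min (max (f x) 0) 1 := by
  have hmem : MemLp (fun x => min (max (f x) 0) 1) 2 m := by
    refine (Lp.memLp f).mono ?_ (Eventually.of_forall fun x => ?_)
    · exact ((Lp.aestronglyMeasurable f).sup aestronglyMeasurable_const).inf
        aestronglyMeasurable_const
    · rw [Real.norm_eq_abs, Real.norm_eq_abs,
        abs_of_nonneg (le_min (le_max_right _ _) zero_le_one)]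
      exact (min_le_left _ _).trans (max_le (le_abs_self _) (abs_nonneg _))
  exact ⟨hmem.toLp _, hmem.coeFn_toLp⟩

/-- The unit contraction is the `L²` projection onto `[0, 1]`-valued functions, in variational
form. -/
theorem inner_sub_unitContraction_nonneg {X : Type*} [MeasurableSpace X] {m : Measure X}
    {f g h : Lp ℝ 2 m} (hg : (g : X → ℝ) =ᵐ[m] fun x => min (max (f x) 0) 1)
    (hh : ∀ᵐ x ∂m, 0 ≤ h x ∧ h x ≤ 1) : 0 ≤ ⟪g - h, f - g⟫ := by
  rw [L2.inner_def]
  refine integral_nonneg_of_ae ?_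
  filter_upwards [hg, hh, Lp.coeFn_sub g h, Lp.coeFn_sub f g] with x hgx hhx h₁ h₂
  obtain ⟨h0, h1⟩ := hhx
  simp only [Pi.zero_apply, h₁, h₂, Pi.sub_apply, hgx, RCLike.inner_apply,
    conj_trivial]
  rcases le_total (f x) 0 with ha | ha
  · rw [max_eq_right ha, min_eq_left zero_le_one]
    nlinarith
  · rw [max_eq_left ha]
    rcases le_total (f x) 1 with hb | hb
    · rw [min_eq_left hb]
      simp
    · rw [min_eq_right hb]
      nlinarith

/-- A bound for nonnegative solutions of a quadratic inequality. -/
theorem le_of_mul_sq_le_mul_add {c A B x : ℝ} (hc : 0 < c) (hA : 0 ≤ A) (hB : 0 ≤ B)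
    (h : c * x ^ 2 ≤ A * x + B) : x ≤ (A + B) / c + 1 := by
  by_contra! hx
  have h0 : 0 ≤ (A + B) / c := by positivity
  have h1 : A + B < c * x := by
    have : (A + B) / c < x := by linarith
    rwa [div_lt_iff₀' hc] at this
  nlinarith

/-- If the resolvents of a lower bounded coercive closed form on `L²(X,m)` are
sub-Markov (`0 ≤ f ≤ 1` a.e. implies `0 ≤ β G_β f ≤ 1` a.e.), then the Markov
property (E.4) holds: for every `u ∈ F` the unit contraction `u⁺ ∧ 1` belongs to
`F` and `E(u⁺ ∧ 1, u − u⁺ ∧ 1) ≥ 0`. -/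
theorem markov_property_of_resolvent_subMarkov
    {X : Type*} [MeasurableSpace X] (m : Measure X)
    {F : Type*} [NormedAddCommGroup F] [InnerProductSpace ℝ F] [CompleteSpace F]
    (ι : F →L[ℝ] Lp ℝ 2 m) (hinj : Function.Injective ι) (hdense : DenseRange ι)
    (E : F →ₗ[ℝ] F →ₗ[ℝ] ℝ) (α K : ℝ) (hα : 0 ≤ α) (hK : 1 ≤ K)
    (h1 : ∀ u : F, 0 ≤ E u u + α * ‖ι u‖ ^ 2)
    (h2 : ∀ u v : F, |E u v| ≤ K * ‖u‖ * ‖v‖)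
    (h3 : ∀ β > α, ∃ c > 0, ∀ u : F, c * ‖u‖ ^ 2 ≤ E u u + β * ‖ι u‖ ^ 2)
    (G : ℝ → Lp ℝ 2 m → F)
    (hG : ∀ β > α, ∀ f : Lp ℝ 2 m, ∀ u : F,
      E (G β f) u + β * ⟪ι (G β f), ι u⟫ = ⟪f, ι u⟫)
    (hsub : ∀ β > α, ∀ f : Lp ℝ 2 m, (∀ᵐ x ∂m, 0 ≤ f x ∧ f x ≤ 1) →
      ∀ᵐ x ∂m, 0 ≤ β * ι (G β f) x ∧ β * ι (G β f) x ≤ 1) :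
    ∀ u : F, ∃ w : F,
      (ι w : X → ℝ) =ᵐ[m] (fun x => min (max (ι u x) 0) 1) ∧ 0 ≤ E w (u - w) := by
  intro u
  obtain ⟨v, hv⟩ := exists_Lp_coeFn_eq_unitContraction (ι u)
  obtain ⟨c, hc, hcoer⟩ := h3 (α + 1) (by linarith)
  have hv01 : ∀ᵐ x ∂m, 0 ≤ v x ∧ v x ≤ 1 := by
    filter_upwards [hv] with x hx
    rw [hx]
    exact ⟨le_min (le_max_right _ _) zero_le_one, min_le_right _ _⟩
  let b : ℕ → ℝ := fun n => n + 2 * (α + 1)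
  have hbn : ∀ n : ℕ, (n : ℝ) ≤ b n := fun n => by simp only [b]; linarith
  have hb2 : ∀ n, 2 * (α + 1) ≤ b n := fun n => by
    simp only [b]; linarith [n.cast_nonneg (α := ℝ)]
  have hbα : ∀ n, α < b n := fun n => by linarith [hb2 n]
  let a : ℕ → F := fun n => b n • G (b n) v
  have haE : ∀ n z, E (a n) z = b n * ⟪v - ι (a n), ι z⟫ := by
    intro n z
    have := hG (b n) (hbα n) v z
    simp only [a, map_smul, LinearMap.smul_apply, smul_eq_mul, inner_sub_left,
      real_inner_smul_left]
    linear_combination b n * this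
  have ha01 : ∀ n, ∀ᵐ x ∂m, 0 ≤ ι (a n) x ∧ ι (a n) x ≤ 1 := by
    intro n
    have hs : ι (a n) = b n • ι (G (b n) v) := by simp [a]
    rw [hs]
    filter_upwards [hsub (b n) (hbα n) v hv01, Lp.coeFn_smul (b n) (ι (G (b n) v))] with x hx hx'
    rw [hx']
    exact hx
  have hkey : ∀ n, b n * ‖v - ι (a n)‖ ^ 2 ≤ E (a n) (u - a n) := by
    intro n
    have hp := inner_sub_unitContraction_nonneg hv (ha01 n)
    have hsplit : ι (u - a n) = (ι u - v) + (v - ι (a n)) := by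
      rw [map_sub]; abel
    rw [haE, hsplit, inner_add_right, real_inner_self_eq_norm_sq]
    have := hb2 n
    nlinarith [mul_nonneg (show 0 ≤ b n by linarith) hp]
  have hkey' : ∀ n, E (a n) (a n) + b n * ‖v - ι (a n)‖ ^ 2 ≤ K * ‖u‖ * ‖a n‖ := by
    intro n
    have h := hkey n
    rw [map_sub] at h
    nlinarith [(le_abs_self _).trans (h2 (a n) u)]
  have hbound : ∀ n, ‖a n‖ ≤ (K * ‖u‖ + 2 * (α + 1) * ‖v‖ ^ 2) / c + 1 := by
    intro n
    refine le_of_mul_sq_le_mul_add hc (by positivity) (by positivity) ?_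
    have htri : ‖ι (a n)‖ ≤ ‖v‖ + ‖v - ι (a n)‖ := by
      simpa using norm_sub_le v (v - ι (a n))
    have hsq : ‖ι (a n)‖ ^ 2 ≤ 2 * ‖v‖ ^ 2 + 2 * ‖v - ι (a n)‖ ^ 2 := by
      nlinarith [norm_nonneg (ι (a n)), sq_nonneg (‖v‖ - ‖v - ι (a n)‖)]
    have h4 := mul_le_mul_of_nonneg_left hsq (show 0 ≤ α + 1 by linarith)
    have h5 := mul_le_mul_of_nonneg_right (hb2 n) (sq_nonneg ‖v - ι (a n)‖)
    linarith [hcoer (a n), hkey' n]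
  set R := (K * ‖u‖ + 2 * (α + 1) * ‖v‖ ^ 2) / c + 1
  have hlim : Tendsto (fun n => ι (a n)) atTop (𝓝 v) := by
    set M := K * ‖u‖ * R + α * (‖ι‖ * R) ^ 2
    have hM : ∀ n, b n * ‖v - ι (a n)‖ ^ 2 ≤ M := by
      intro n
      have h4 : ‖ι (a n)‖ ≤ ‖ι‖ * R :=
        (ι.le_opNorm _).trans (mul_le_mul_of_nonneg_left (hbound n) (norm_nonneg _))
      have h5 : α * ‖ι (a n)‖ ^ 2 ≤ α * (‖ι‖ * R) ^ 2 := by gcongr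
      have h6 : K * ‖u‖ * ‖a n‖ ≤ K * ‖u‖ * R :=
        mul_le_mul_of_nonneg_left (hbound n) (by positivity)
      linarith [h1 (a n), hkey' n]
    have hbtop : Tendsto b atTop atTop :=
      tendsto_atTop_mono hbn tendsto_natCast_atTop_atTop
    have hsq : Tendsto (fun n => ‖ι (a n) - v‖ ^ 2) atTop (𝓝 0) := by
      refine squeeze_zero (fun n => sq_nonneg _) (fun n => ?_) (hbtop.const_div_atTop M)
      rw [norm_sub_rev, le_div_iff₀' (by linarith [hb2 n])]
      exact hM n
    rw [tendsto_iff_norm_sub_tendsto_zero]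
    simpa using hsq.sqrt
  obtain ⟨l, hl, w, hw⟩ := exists_ultrafilter_tendsto_weak hbound
  have hιw : ι w = v := by
    refine ext_inner_left ℝ fun h => ?_
    exact tendsto_nhds_unique (hw ((innerSL ℝ h).comp ι))
      (((innerSL ℝ h).continuous.tendsto v).comp (hlim.mono_left hl))
  have hright : ∀ z, Tendsto (fun n => E z (a n)) l (𝓝 (E z w)) := fun z =>
    hw ((E z).mkContinuous (K * ‖z‖) (h2 z))
  have hleft : ∀ z, Tendsto (fun n => E (a n) z) l (𝓝 (E w z)) := fun z =>
    hw ((E.flip z).mkContinuous (K * ‖z‖) fun y => by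
      have := h2 y z
      rwa [mul_right_comm] at this)
  refine ⟨w, by rw [hιw]; exact hv, ?_⟩
  have hdist : Tendsto (fun n => ‖ι (a n) - v‖ ^ 2) l (𝓝 0) := by
    simpa using ((tendsto_iff_norm_sub_tendsto_zero.1 hlim).mono_left hl).pow 2
  have hlsc := (((hleft u).sub (hleft w)).sub (hright w)).add (hdist.const_mul α)
  have hge := ge_of_tendsto' (b := -E w w) hlsc fun n => by
    have h4 := h1 (a n - w)
    have h5 := hkey n
    have h6 : 0 ≤ b n * ‖v - ι (a n)‖ ^ 2 := mul_nonneg (by linarith [hb2 n]) (sq_nonneg _)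
    simp only [map_sub, LinearMap.sub_apply, hιw] at h4 h5
    linarith
  rw [map_sub]
  linarith
end

section
/- Let (X,m) be a measure space and H = L²(X,m) the real Hilbert space of square-integrable functions. Let F ⊆ H be a dense subspace which is itself a real Hilbert space with norm ‖·‖_F whose inclusion into H is continuous, E : F → F → ℝ a bilinear form, and K ≥ 1 a constant such that: E(u,u) ≥ 0 for all u ∈ F; |E(u,v)| ≤ K‖u‖_F‖v‖_F for all u,v ∈ F; there is c > 0 with E(u,u) + ‖u‖_H² ≥ c‖u‖_F² for all u ∈ F. Assume that for every u ∈ F the unit contraction u⁺ ∧ 1 belongs to F. Then the following are equivalent: (i) for every u ∈ F, E(u⁺ ∧ 1, u − u⁺ ∧ 1) ≥ 0; (ii) for every u ∈ F, E(u + u⁺ ∧ 1, u − u⁺ ∧ 1) ≥ 0. -/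
open MeasureTheory
open scoped RealInnerProductSpace

/-- Moving from the projection of `a` onto `[0, 1]` along the ray through `a` does not change
the projection. -/
theorem min_max_add_smul_sub_min_max (a : ℝ) {t : ℝ} (ht : 0 ≤ t) :
    min (max (min (max a 0) 1 + t * (a - min (max a 0) 1)) 0) 1 = min (max a 0) 1 := by
  rcases le_total a 0 with h0 | h0
  · have : t * a ≤ 0 := mul_nonpos_of_nonneg_of_nonpos ht h0
    simp [h0, this]
  · rcases le_total a 1 with h | h
    · simp [h0, h]
    · have : 0 ≤ t * (a - 1) := mul_nonneg ht (sub_nonneg.2 h)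
      rw [max_eq_left h0, min_eq_right h, max_eq_left (by linarith), min_eq_right (by linarith)]

/-- For a coercive closed form `(E, F)` on `L²(X,m)` with nonnegative diagonal whose
domain is stable under unit contraction, the two forms of the Markov property are
equivalent: `E(u⁺ ∧ 1, u − u⁺ ∧ 1) ≥ 0` for all `u ∈ F` iff
`E(u + u⁺ ∧ 1, u − u⁺ ∧ 1) ≥ 0` for all `u ∈ F`. -/
theorem markov_property_iff
    {X : Type*} [MeasurableSpace X] (m : Measure X)
    {F : Type*} [NormedAddCommGroup F] [InnerProductSpace ℝ F] [CompleteSpace F]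
    (ι : F →L[ℝ] Lp ℝ 2 m) (hinj : Function.Injective ι) (hdense : DenseRange ι)
    (E : F →ₗ[ℝ] F →ₗ[ℝ] ℝ) (K : ℝ) (hK : 1 ≤ K)
    (h1 : ∀ u : F, 0 ≤ E u u)
    (h2 : ∀ u v : F, |E u v| ≤ K * ‖u‖ * ‖v‖)
    (h3 : ∃ c > 0, ∀ u : F, c * ‖u‖ ^ 2 ≤ E u u + ‖ι u‖ ^ 2)
    (hcontr : ∀ u : F, ∃ w : F,
      (ι w : X → ℝ) =ᵐ[m] (fun x => min (max (ι u x) 0) 1)) :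
    (∀ u w : F, (ι w : X → ℝ) =ᵐ[m] (fun x => min (max (ι u x) 0) 1) →
        0 ≤ E w (u - w)) ↔
      (∀ u w : F, (ι w : X → ℝ) =ᵐ[m] (fun x => min (max (ι u x) 0) 1) →
        0 ≤ E (u + w) (u - w)) := by
  refine ⟨fun h u w hw => ?_, fun h u w hw => ?_⟩
  · have hsum : E (u + w) (u - w) = E (u - w) (u - w) + 2 * E w (u - w) := by
      simp only [map_add, map_sub, LinearMap.add_apply, LinearMap.sub_apply]
      ring
    rw [hsum]
    linarith [h1 (u - w), h u w hw]
  · have hray : ∀ t : ℝ, 0 < t → 0 ≤ 2 * E w (u - w) + t * E (u - w) (u - w) := by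
      intro t ht
      have hcontr_ray : (ι w : X → ℝ) =ᵐ[m]
          fun x => min (max (ι (w + t • (u - w)) x) 0) 1 := by
        rw [map_add, map_smul, map_sub]
        filter_upwards [hw, Lp.coeFn_add (ι w) (t • (ι u - ι w)),
          Lp.coeFn_smul t (ι u - ι w), Lp.coeFn_sub (ι u) (ι w)] with x hx hadd hsmul hsub
        rw [hadd, Pi.add_apply, hsmul, Pi.smul_apply, hsub, Pi.sub_apply, smul_eq_mul, hx,
          min_max_add_smul_sub_min_max _ ht.le]
      have hE := h _ w hcontr_ray
      have hexp : E (w + t • (u - w) + w) (w + t • (u - w) - w) =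
          t * (2 * E w (u - w) + t * E (u - w) (u - w)) := by
        rw [add_sub_cancel_left]
        simp only [map_add, map_smul, LinearMap.add_apply, LinearMap.smul_apply, smul_eq_mul]
        ring
      rw [hexp] at hE
      exact nonneg_of_mul_nonneg_right hE ht
    by_contra! hneg
    have hpos : 0 < E (u - w) (u - w) + 1 := by linarith [h1 (u - w)]
    have ht := hray (-E w (u - w) / (E (u - w) (u - w) + 1)) (div_pos (neg_pos.2 hneg) hpos)
    have hle : -E w (u - w) / (E (u - w) (u - w) + 1) * E (u - w) (u - w) ≤ -E w (u - w) := by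
      rw [div_mul_eq_mul_div, div_le_iff₀ hpos]
      nlinarith
    linarith
end
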